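/- Let (f,M) be a polymatroid on a finite set M that has a non-principal modular cut. Then (f,M) is not sticky: there exist two extensions (g1,N1) and (g2,N2) of (f,M) with N1 ∩ N2 = M that have no amalgam. -/

import Mathlib

open scoped Classical

/-- A polymatroid on the finite ground set `M`: `f` is zero on the empty set,
nonnegative, monotone and submodular on subsets of `M`. -/
def IsPolymatroid {α : Type*} [DecidableEq α] (M : Finset α) (f : Finset α → ℝ) : Prop :=
  f ∅ = 0 ∧
  (∀ A, A ⊆ M → 0 ≤ f A) ∧
  (∀ A B, A ⊆ B → B ⊆ M → f A ≤ f B) ∧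
  (∀ A B, A ⊆ M → B ⊆ M → f (A ∪ B) + f (A ∩ B) ≤ f A + f B)

/-- `F` is a flat of the polymatroid `(f, M)`: every proper superset inside `M`
has strictly larger rank. -/
def IsFlat {α : Type*} [DecidableEq α] (M : Finset α) (f : Finset α → ℝ) (F : Finset α) : Prop :=
  F ⊆ M ∧ ∀ G, F ⊂ G → G ⊆ M → f F < f G

/-- The modular defect of a pair of subsets. -/
def modularDefect {α : Type*} [DecidableEq α] (f : Finset α → ℝ) (A B : Finset α) : ℝ :=
  f A + f B - f (A ∩ B) - f (A ∪ B)

/-- A modular cut: a collection of flats, closed upwards among flats,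
and closed under intersections of modular pairs. -/
def IsModularCut {α : Type*} [DecidableEq α] (M : Finset α) (f : Finset α → ℝ)
    (𝓜 : Set (Finset α)) : Prop :=
  (∀ F ∈ 𝓜, IsFlat M f F) ∧
  (∀ F₁ ∈ 𝓜, ∀ F₂, IsFlat M f F₂ → F₁ ⊆ F₂ → F₂ ∈ 𝓜) ∧
  (∀ F₁ ∈ 𝓜, ∀ F₂ ∈ 𝓜, modularDefect f F₁ F₂ = 0 → F₁ ∩ F₂ ∈ 𝓜)

/-- A modular cut is principal if it is empty or the intersection of all of its
elements (taken inside the ground set `M`) is one of its elements. -/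
def IsPrincipal {α : Type*} [DecidableEq α] (M : Finset α) (𝓜 : Set (Finset α)) : Prop :=
  𝓜 = ∅ ∨ (M.filter fun x => ∀ F ∈ 𝓜, x ∈ F) ∈ 𝓜

/-- `(g, N)` is an extension of the polymatroid `(f, M)`. -/
def IsExtension {α : Type*} [DecidableEq α] (M : Finset α) (f : Finset α → ℝ)
    (N : Finset α) (g : Finset α → ℝ) : Prop :=
  M ⊆ N ∧ IsPolymatroid N g ∧ ∀ A, A ⊆ M → g A = f A

/-- `h` is an amalgam of the two extensions `(g₁, N₁)` and `(g₂, N₂)`. -/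
def IsAmalgam {α : Type*} [DecidableEq α] (N₁ : Finset α) (g₁ : Finset α → ℝ)
    (N₂ : Finset α) (g₂ : Finset α → ℝ) (h : Finset α → ℝ) : Prop :=
  IsPolymatroid (N₁ ∪ N₂) h ∧ (∀ A, A ⊆ N₁ → h A = g₁ A) ∧ (∀ A, A ⊆ N₂ → h A = g₂ A)

/-- A polymatroid is sticky if every two extensions intersecting exactly
in the ground set have an amalgam. -/
def Sticky {α : Type*} [DecidableEq α] (M : Finset α) (f : Finset α → ℝ) : Prop :=
  ∀ N₁ g₁ N₂ g₂, IsExtension M f N₁ g₁ → IsExtension M f N₂ g₂ → N₁ ∩ N₂ = M →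
    ∃ h, IsAmalgam N₁ g₁ N₂ g₂ h

/-- Closure: every subset of `M` lies in a flat of the same rank. -/
theorem exists_flat {α : Type*} [DecidableEq α] (M : Finset α) (f : Finset α → ℝ)
    (hf : IsPolymatroid M f) (A : Finset α) (hA : A ⊆ M) :
    ∃ G, IsFlat M f G ∧ A ⊆ G ∧ f G = f A := by
  obtain ⟨G, hG, hmax⟩ := Finset.exists_max_image
    (M.powerset.filter fun G => A ⊆ G ∧ f G = f A) Finset.card ⟨A, by simp [hA]⟩
  simp only [Finset.mem_filter, Finset.mem_powerset] at hG hmax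
  refine ⟨G, ⟨hG.1, fun H hGH hH => ?_⟩, hG.2.1, hG.2.2⟩
  refine lt_of_le_of_ne (hf.2.2.1 G H hGH.1 hH) fun heq => ?_
  have := hmax H ⟨hH, hG.2.1.trans hGH.1, by rw [← heq, hG.2.2]⟩
  have := Finset.card_lt_card hGH
  omega

/-- A non-principal modular cut is not closed under intersection. -/
theorem exists_pair {α : Type*} [DecidableEq α]
    (M : Finset α) (f : Finset α → ℝ)
    (𝓜 : Set (Finset α)) (h𝓜 : IsModularCut M f 𝓜) (hnp : ¬ IsPrincipal M 𝓜) :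
    ∃ F₁ ∈ 𝓜, ∃ F₂ ∈ 𝓜, F₁ ∩ F₂ ∉ 𝓜 := by
  by_contra! hcl
  apply hnp
  by_cases hne : 𝓜 = ∅
  · exact Or.inl hne
  right
  obtain ⟨F₀, hF₀⟩ := Set.nonempty_iff_ne_empty.mpr hne
  obtain ⟨G, hG, hmin⟩ := Finset.exists_min_image
    (M.powerset.filter fun G => G ∈ 𝓜) Finset.card ⟨F₀, by simp [hF₀, (h𝓜.1 F₀ hF₀).1]⟩
  simp only [Finset.mem_filter, Finset.mem_powerset] at hG hmin
  have hle : ∀ F ∈ 𝓜, G ⊆ F := by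
    intro F hF
    have h1 := hmin (G ∩ F) ⟨Finset.inter_subset_left.trans hG.1, hcl G hG.2 F hF⟩
    have := Finset.eq_of_subset_of_card_le (Finset.inter_subset_left (s₁ := G) (s₂ := F)) h1
    exact Finset.inter_eq_left.mp this
  convert hG.2 using 1
  ext z
  simp only [Finset.mem_filter]
  exact ⟨fun h => h.2 G hG.2, fun h => ⟨hG.1 h, fun F hF => hle F hF h⟩⟩

/-- The one-element extension. -/
theorem ext_one {α : Type*} [DecidableEq α] (M : Finset α) (f σ : Finset α → ℝ)
    (hf : IsPolymatroid M f)
    (hmono : ∀ A B, A ⊆ B → B ⊆ M → σ A ≤ σ B)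
    (hsub : ∀ A B, A ⊆ M → B ⊆ M → σ (A ∪ B) + σ (A ∩ B) ≤ σ A + σ B)
    (hmix : ∀ A B, A ⊆ M → B ⊆ M → σ (A ∪ B) + f (A ∩ B) ≤ f A + σ B)
    (hge : ∀ A, A ⊆ M → f A ≤ σ A) (e : α) (he : e ∉ M) :
    IsExtension M f (insert e M)
      (fun S => if e ∈ S then σ (S ∩ M) else f (S ∩ M)) := by
  obtain ⟨f0, fnn, fmono, fsub⟩ := hf
  have hr : ∀ S : Finset α, S ∩ M ⊆ M := fun S => Finset.inter_subset_right
  have hu : ∀ A B : Finset α, (A ∪ B) ∩ M = (A ∩ M) ∪ (B ∩ M) := by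
    intro A B; exact Finset.union_inter_distrib_right A B M
  have hi : ∀ A B : Finset α, (A ∩ B) ∩ M = (A ∩ M) ∩ (B ∩ M) := by
    intro A B; ext; simp only [Finset.mem_inter]; tauto
  refine ⟨Finset.subset_insert _ _, ⟨by simp [f0], ?_, ?_, ?_⟩, ?_⟩
  · intro A _
    have := fnn _ (hr A)
    have := hge _ (hr A)
    dsimp only
    split_ifs <;> linarith
  · intro A B hAB _
    have hs : A ∩ M ⊆ B ∩ M := Finset.inter_subset_inter_right hAB
    have h1 := fmono _ _ hs (hr B)
    have h2 := hmono _ _ hs (hr B)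
    have h3 := hge _ (hr B)
    have h4 := @hAB e
    dsimp only
    split_ifs <;> first | linarith | tauto
  · intro A B _ _
    have h1 := fsub _ _ (hr A) (hr B)
    have h2 := hsub _ _ (hr A) (hr B)
    have h3 := hmix _ _ (hr A) (hr B)
    have h4 := hmix _ _ (hr B) (hr A)
    rw [Finset.union_comm, Finset.inter_comm (B ∩ M)] at h4
    simp only [Finset.mem_union, Finset.mem_inter, hu, hi]
    by_cases hA : e ∈ A <;> by_cases hB : e ∈ B <;> simp only [hA, hB, or_true, or_false,
      and_true, and_false, if_true, if_false, and_self, or_self] <;> linarith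
  · intro A hA
    have : e ∉ A := fun h => he (hA h)
    simp [this, Finset.inter_eq_left.mpr hA]

/-- The two-element, Vamos-like extension. -/
theorem ext_two {α : Type*} [DecidableEq α] (M : Finset α) (f τ : Finset α → ℝ) (T : ℝ)
    (hf : IsPolymatroid M f)
    (hmono : ∀ A B, A ⊆ B → B ⊆ M → τ A ≤ τ B)
    (hsub : ∀ A B, A ⊆ M → B ⊆ M → τ (A ∪ B) + τ (A ∩ B) ≤ τ A + τ B)
    (hmix : ∀ A B, A ⊆ M → B ⊆ M → τ (A ∪ B) + f (A ∩ B) ≤ f A + τ B)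
    (hge : ∀ A, A ⊆ M → f A ≤ τ A) (hT : ∀ A, A ⊆ M → τ A ≤ T)
    (hX : ∀ A B, A ⊆ M → B ⊆ M → T + f (A ∩ B) ≤ τ A + τ B)
    (x y : α) (hx : x ∉ M) (hy : y ∉ M) :
    IsExtension M f (insert x (insert y M))
      (fun S => if x ∈ S then (if y ∈ S then T else τ (S ∩ M))
        else (if y ∈ S then τ (S ∩ M) else f (S ∩ M))) := by
  obtain ⟨f0, fnn, fmono, fsub⟩ := hf
  have hr : ∀ S : Finset α, S ∩ M ⊆ M := fun S => Finset.inter_subset_right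
  have hu : ∀ A B : Finset α, (A ∪ B) ∩ M = (A ∩ M) ∪ (B ∩ M) := by
    intro A B; exact Finset.union_inter_distrib_right A B M
  have hi : ∀ A B : Finset α, (A ∩ B) ∩ M = (A ∩ M) ∩ (B ∩ M) := by
    intro A B; ext; simp only [Finset.mem_inter]; tauto
  refine ⟨(Finset.subset_insert _ _).trans (Finset.subset_insert _ _),
    ⟨by simp [f0], ?_, ?_, ?_⟩, ?_⟩
  · intro A _
    have := fnn _ (hr A)
    have := hge _ (hr A)
    have := hT _ (hr A)
    dsimp only
    split_ifs <;> linarith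
  · intro A B hAB _
    have hs : A ∩ M ⊆ B ∩ M := Finset.inter_subset_inter_right hAB
    have h1 := fmono _ _ hs (hr B)
    have h2 := hmono _ _ hs (hr B)
    have h3 := hge _ (hr B)
    have h5 := hT _ (hr B)
    have h4 := @hAB x
    have h6 := @hAB y
    dsimp only
    split_ifs <;> first | linarith | tauto
  · intro A B _ _
    have h1 := fsub _ _ (hr A) (hr B)
    have h2 := hsub _ _ (hr A) (hr B)
    have h3 := hmix _ _ (hr A) (hr B)
    have h4 := hmix _ _ (hr B) (hr A)
    rw [Finset.union_comm, Finset.inter_comm (B ∩ M)] at h4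
    have h5 := hX _ _ (hr A) (hr B)
    have sA : (A ∩ M) ∩ (B ∩ M) ⊆ A ∩ M := Finset.inter_subset_left
    have sB : (A ∩ M) ∩ (B ∩ M) ⊆ B ∩ M := Finset.inter_subset_right
    have h6 := fmono _ _ sA (hr A)
    have h7 := fmono _ _ sB (hr B)
    have h8 := hmono _ _ sA (hr A)
    have h9 := hmono _ _ sB (hr B)
    simp only [Finset.mem_union, Finset.mem_inter, hu, hi]
    by_cases hA : x ∈ A <;> by_cases hB : x ∈ B <;> by_cases hA' : y ∈ A <;>
      by_cases hB' : y ∈ B <;>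
      simp only [hA, hB, hA', hB', or_true, or_false,
      and_true, and_false, if_true, if_false, and_self, or_self] <;> linarith
  · intro A hA
    have h1 : x ∉ A := fun h => hx (hA h)
    have h2 : y ∉ A := fun h => hy (hA h)
    simp [h1, h2, Finset.inter_eq_left.mpr hA]

set_option maxHeartbeats 2000000 in
theorem main_ext {α : Type*} [DecidableEq α] [Infinite α]
    (M : Finset α) (f : Finset α → ℝ) (hf : IsPolymatroid M f)
    (𝓜 : Set (Finset α)) (h𝓜 : IsModularCut M f 𝓜) (hnp : ¬ IsPrincipal M 𝓜) :
    ∃ N₁ g₁ N₂ g₂, IsExtension M f N₁ g₁ ∧ IsExtension M f N₂ g₂ ∧ N₁ ∩ N₂ = M ∧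
      ¬ ∃ h, IsAmalgam N₁ g₁ N₂ g₂ h := by
  have hf' := hf
  obtain ⟨f0, fnn, fmono, fsub⟩ := hf'
  obtain ⟨hfl, hup, hmod⟩ := h𝓜
  have hM : ∀ F ∈ 𝓜, F ⊆ M := fun F hF => (hfl F hF).1
  -- the pair of smallest defect
  obtain ⟨P₁, hP₁, P₂, hP₂, hP⟩ := exists_pair M f 𝓜 ⟨hfl, hup, hmod⟩ hnp
  obtain ⟨⟨F₁, F₂⟩, hF, hmin⟩ := Finset.exists_min_image
    ((M.powerset ×ˢ M.powerset).filter fun p => p.1 ∈ 𝓜 ∧ p.2 ∈ 𝓜 ∧ p.1 ∩ p.2 ∉ 𝓜)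
    (fun p => modularDefect f p.1 p.2)
    ⟨(P₁, P₂), by simp [hP₁, hP₂, hP, hM P₁ hP₁, hM P₂ hP₂]⟩
  simp only [Finset.mem_filter, Finset.mem_product, Finset.mem_powerset] at hF
  obtain ⟨-, hF₁, hF₂, hI⟩ := hF
  have hmin' : ∀ A ∈ 𝓜, ∀ B ∈ 𝓜, A ∩ B ∉ 𝓜 → modularDefect f F₁ F₂ ≤ modularDefect f A B := by
    intro A hA B hB hAB
    exact hmin (A, B) (by simp [hA, hB, hAB, hM A hA, hM B hB])
  clear hmin
  obtain ⟨I, hIdef⟩ : ∃ I, I = F₁ ∩ F₂ := ⟨_, rfl⟩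
  obtain ⟨δ, hδ⟩ : ∃ δ, δ = modularDefect f F₁ F₂ := ⟨_, rfl⟩
  rw [← hδ] at hmin'
  have hM1 := hM _ hF₁
  have hM2 := hM _ hF₂
  have hIM : I ⊆ M := by rw [hIdef]; exact Finset.inter_subset_left.trans hM1
  have δpos : 0 < δ := by
    have h1 := fsub F₁ F₂ hM1 hM2
    have h2 : modularDefect f F₁ F₂ ≠ 0 := fun h => hI (hmod F₁ hF₁ F₂ hF₂ h)
    rw [← hδ] at h2
    refine lt_of_le_of_ne ?_ h2.symm
    rw [hδ]; unfold modularDefect; linarith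
  have hMin : M ∈ 𝓜 := hup F₁ hF₁ M
    ⟨subset_rfl, fun G hG hGM => absurd hGM hG.2⟩ hM1
  -- flats of the cut above `I` have rank larger than `f I + δ`
  have hstep : ∀ A ∈ 𝓜, ∀ B ∈ 𝓜, A ∩ B ∉ 𝓜 → f (A ∩ B) + δ < f A := by
    intro A hA B hB hAB
    have h1 := hmin' A hA B hB hAB
    have h2 := (hfl B hB).2 (A ∪ B) ⟨Finset.subset_union_right, fun h => hAB (by
      rw [Finset.inter_eq_left.mpr (Finset.subset_union_left.trans h)]; exact hA)⟩
      (Finset.union_subset (hM A hA) (hM B hB))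
    unfold modularDefect at h1
    linarith
  have hbig : ∀ B ∈ 𝓜, I ⊆ B → f I + δ < f B := by
    intro B hB hIB
    have s1 : I ⊆ F₁ := by rw [hIdef]; exact Finset.inter_subset_left
    have s2 : I ⊆ F₂ := by rw [hIdef]; exact Finset.inter_subset_right
    by_cases h1 : B ∩ F₁ ∈ 𝓜
    · have e1 : (B ∩ F₁) ∩ F₂ = I := by
        rw [Finset.inter_assoc, ← hIdef]; exact Finset.inter_eq_right.mpr hIB
      have := hstep _ h1 F₂ hF₂ (by rw [e1, hIdef]; exact hI)
      rw [e1] at this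
      have := fmono (B ∩ F₁) B Finset.inter_subset_left (hM B hB)
      linarith
    · have := hstep B hB F₁ hF₁ h1
      have := fmono I (B ∩ F₁) (Finset.subset_inter hIB s1)
        (Finset.inter_subset_left.trans (hM B hB))
      linarith
  obtain ⟨η, ηpos, ηδ, hη⟩ : ∃ η, 0 < η ∧ η ≤ δ ∧ ∀ B ∈ 𝓜, I ⊆ B → f I + δ + η ≤ f B := by
    obtain ⟨B₀, hB₀, hB₀min⟩ := Finset.exists_min_image
      (M.powerset.filter fun B => B ∈ 𝓜 ∧ I ⊆ B) f ⟨M, by simp [hMin, hIM]⟩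
    simp only [Finset.mem_filter, Finset.mem_powerset] at hB₀ hB₀min
    have h0 := hbig B₀ hB₀.2.1 hB₀.2.2
    refine ⟨min δ (f B₀ - f I - δ), lt_min δpos (by linarith), min_le_left _ _, ?_⟩
    intro B hB hIB
    have := hB₀min B ⟨hM B hB, hB, hIB⟩
    have := min_le_right δ (f B₀ - f I - δ)
    linarith
  -- the rank of the new element together with `A`
  have hσ : ∀ A, ∃ r : ℝ, r ≤ f A + δ ∧ (∀ F ∈ 𝓜, A ⊆ F → r ≤ f F) ∧
      (r = f A + δ ∨ ∃ F ∈ 𝓜, A ⊆ F ∧ r = f F) := by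
    intro A
    by_cases hA : A ⊆ M
    · obtain ⟨B₀, hB₀, hB₀min⟩ := Finset.exists_min_image
        (M.powerset.filter fun B => B ∈ 𝓜 ∧ A ⊆ B) f ⟨M, by simp [hMin, hA]⟩
      simp only [Finset.mem_filter, Finset.mem_powerset] at hB₀ hB₀min
      refine ⟨min (f A + δ) (f B₀), min_le_left _ _, ?_, ?_⟩
      · intro F hF hAF
        exact (min_le_right _ _).trans (hB₀min F ⟨hM F hF, hF, hAF⟩)
      · rcases min_choice (f A + δ) (f B₀) with h | h
        · exact Or.inl h
        · exact Or.inr ⟨B₀, hB₀.2.1, hB₀.2.2, h⟩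
    · exact ⟨f A + δ, le_rfl, fun F hF h => absurd (h.trans (hM F hF)) hA, Or.inl rfl⟩
  choose σ σδ σF σor using hσ
  have σmono : ∀ A B, A ⊆ B → B ⊆ M → σ A ≤ σ B := by
    intro A B hAB hB
    rcases σor B with h | ⟨F, hF, hBF, h⟩
    · have := fmono A B hAB hB
      have := σδ A
      linarith
    · rw [h]; exact σF A F hF (hAB.trans hBF)
  have σge : ∀ A, A ⊆ M → f A ≤ σ A := by
    intro A hA
    rcases σor A with h | ⟨F, hF, hAF, h⟩
    · linarith
    · rw [h]; exact fmono _ _ hAF (hM F hF)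
  -- rank above an element of the cut
  have σU : ∀ F ∈ 𝓜, ∀ A B, F ⊆ B → A ⊆ B → B ⊆ M → σ A ≤ f B := by
    intro F hF A B hFB hAB hB
    obtain ⟨G, hG, hBG, hfG⟩ := exists_flat M f hf B hB
    rw [← hfG]
    exact σF A G (hup F hF G hG (hFB.trans hBG)) (hAB.trans hBG)
  have σmix : ∀ A B, A ⊆ M → B ⊆ M → σ (A ∪ B) + f (A ∩ B) ≤ f A + σ B := by
    intro A B hA hB
    rcases σor B with h | ⟨F, hF, hBF, h⟩
    · have := fsub A B hA hB
      have := σδ (A ∪ B)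
      linarith
    · have h1 := fsub A F hA (hM F hF)
      have h2 := σU F hF (A ∪ B) (A ∪ F) Finset.subset_union_right
        (Finset.union_subset_union_right hBF) (Finset.union_subset hA (hM F hF))
      have h3 := fmono (A ∩ B) (A ∩ F) (Finset.inter_subset_inter_left hBF)
        (Finset.inter_subset_left.trans hA)
      linarith
  have σsub : ∀ A B, A ⊆ M → B ⊆ M → σ (A ∪ B) + σ (A ∩ B) ≤ σ A + σ B := by
    intro A B hA hB
    have h0 := σδ (A ∩ B)
    rcases σor B with h | ⟨F, hF, hBF, h⟩
    · have h1 := σmix B A hB hA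
      rw [Finset.union_comm, Finset.inter_comm B A] at h1
      linarith
    rcases σor A with h' | ⟨F', hF', hAF, h'⟩
    · have h1 := σmix A B hA hB
      linarith
    · have h1 := fsub F' F (hM F' hF') (hM F hF)
      have h2 := σU F hF (A ∪ B) (F' ∪ F) Finset.subset_union_right
        (Finset.union_subset_union hAF hBF) (Finset.union_subset (hM F' hF') (hM F hF))
      have hss : A ∩ B ⊆ F' ∩ F := Finset.inter_subset_inter hAF hBF
      by_cases hin : F' ∩ F ∈ 𝓜
      · have h3 := σF (A ∩ B) _ hin hss
        linarith
      · have h3 := hmin' F' hF' F hF hin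
        have h4 := fmono _ _ hss (Finset.inter_subset_left.trans (hM F' hF'))
        unfold modularDefect at h3
        linarith
  have σI : f I + δ ≤ σ I := by
    rcases σor I with h | ⟨F, hF, hIF, h⟩
    · linarith
    · have := hη F hF hIF
      linarith
  have σX : ∀ A B, A ⊆ M → B ⊆ M → I ⊆ A → I ⊆ B →
      f I + δ + η + f (A ∩ B) ≤ σ A + σ B := by
    intro A B hA hB hIA hIB
    have a1 := fmono I A hIA hA
    have a2 := fmono (A ∩ B) A Finset.inter_subset_left hA
    have a3 := fmono (A ∩ B) B Finset.inter_subset_right hB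
    have a4 := σge A hA
    rcases σor B with h | ⟨F, hF, hBF, h⟩
    · rcases σor A with h' | ⟨F', hF', hAF, h'⟩
      · linarith
      · have := hη F' hF' (hIA.trans hAF)
        linarith
    · have := hη F hF (hIB.trans hBF)
      linarith
  -- the second extension
  obtain ⟨c, hc⟩ : ∃ c, c = f M := ⟨_, rfl⟩
  have cnn : 0 ≤ c := by rw [hc]; exact fnn M subset_rfl
  have hAI : ∀ A, A ⊆ M → A ∪ I ⊆ M := fun A hA => Finset.union_subset hA hIM
  obtain ⟨τ, hτ⟩ : ∃ τ : Finset α → ℝ, ∀ A, τ A = c + σ (A ∪ I) := ⟨_, fun A => rfl⟩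
  obtain ⟨T, hT⟩ : ∃ T, T = 2 * c + f I + δ + η := ⟨_, rfl⟩
  obtain ⟨e, he⟩ := Infinite.exists_notMem_finset M
  obtain ⟨x, hx⟩ := Infinite.exists_notMem_finset (insert e M)
  obtain ⟨y, hy⟩ := Infinite.exists_notMem_finset (insert x (insert e M))
  simp only [Finset.mem_insert, not_or] at hx hy
  have E1 := ext_one M f σ hf σmono σsub σmix σge e he
  have E2 : IsExtension M f _ _ := ext_two M f τ T hf
    (by
      intro A B hAB hB
      have := σmono _ _ (Finset.union_subset_union_left (t := I) hAB) (hAI B hB)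
      rw [hτ, hτ]; linarith)
    (by
      intro A B hA hB
      have := σsub _ _ (hAI A hA) (hAI B hB)
      rw [← Finset.union_union_distrib_right, ← Finset.inter_union_distrib_right] at this
      rw [hτ, hτ, hτ, hτ]; linarith)
    (by
      intro A B hA hB
      have h1 := σmix A (B ∪ I) hA (hAI B hB)
      rw [← Finset.union_assoc] at h1
      have h2 := fmono (A ∩ B) (A ∩ (B ∪ I))
        (Finset.inter_subset_inter_left Finset.subset_union_left)
        (Finset.inter_subset_left.trans hA)
      rw [hτ, hτ]; linarith)
    (by
      intro A hA
      have h1 := σge _ (hAI A hA)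
      have h2 := fmono A (A ∪ I) Finset.subset_union_left (hAI A hA)
      rw [hτ]; linarith)
    (by
      intro A hA
      have h1 := σF (A ∪ I) M hMin (hAI A hA)
      have := fnn I hIM
      rw [hτ]; linarith)
    (by
      intro A B hA hB
      have h1 := σX _ _ (hAI A hA) (hAI B hB) Finset.subset_union_right Finset.subset_union_right
      have h2 := fmono (A ∩ B) ((A ∪ I) ∩ (B ∪ I))
        (Finset.inter_subset_inter Finset.subset_union_left Finset.subset_union_left)
        (Finset.inter_subset_left.trans (hAI A hA))
      rw [hτ, hτ]; linarith)
    x y hx.2 hy.2.2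
  refine ⟨_, _, _, _, E1, E2, ?_, ?_⟩
  · ext z
    simp only [Finset.mem_inter, Finset.mem_insert]
    constructor
    · rintro ⟨rfl | h, h'⟩
      · rcases h' with h' | h' | h'
        · exact absurd h'.symm hx.1
        · exact absurd h'.symm hy.2.1
        · exact h'
      · exact h
    · exact fun h => ⟨Or.inr h, Or.inr (Or.inr h)⟩
  -- no amalgam
  rintro ⟨h, ⟨-, -, hmono, hsub⟩, H1, H2⟩
  generalize hN : insert e M ∪ insert x (insert y M) = N at hmono hsub
  have heN : e ∈ N := by rw [← hN]; simp
  have hxN : x ∈ N := by rw [← hN]; simp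
  have hyN : y ∈ N := by rw [← hN]; simp
  have hMN : M ⊆ N := by rw [← hN]; intro z hz; simp [hz]
  have s1 : I ⊆ F₁ := by rw [hIdef]; exact Finset.inter_subset_left
  have s2 : I ⊆ F₂ := by rw [hIdef]; exact Finset.inter_subset_right
  have v0 : ∀ A, A ⊆ M → h A = f A := by
    intro A hA
    rw [H1 A (hA.trans (Finset.subset_insert _ _)), E1.2.2 A hA]
  have ve : ∀ A, A ⊆ M → h (insert e A) = σ A := by
    intro A hA
    rw [H1 _ (Finset.insert_subset_insert _ hA)]
    simp [Finset.insert_inter_of_notMem he, Finset.inter_eq_left.mpr hA]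
  have vx : ∀ A, A ⊆ M → h (insert x A) = τ A := by
    intro A hA
    have : y ∉ A := fun h => hy.2.2 (hA h)
    rw [H2 _ (Finset.insert_subset_insert _ (hA.trans (Finset.subset_insert _ _)))]
    simp [Finset.insert_inter_of_notMem hx.2, Finset.inter_eq_left.mpr hA, this, hy.1]
  have vy : ∀ A, A ⊆ M → h (insert y A) = τ A := by
    intro A hA
    have : x ∉ A := fun h => hx.2 (hA h)
    rw [H2 _ ((Finset.insert_subset_insert _ hA).trans (Finset.subset_insert _ _))]
    simp [Finset.insert_inter_of_notMem hy.2.2, Finset.inter_eq_left.mpr hA, this, Ne.symm hy.1]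
  have vxy : ∀ A, A ⊆ M → h (insert x (insert y A)) = T := by
    intro A hA
    rw [H2 _ (Finset.insert_subset_insert _ (Finset.insert_subset_insert _ hA))]
    simp
  -- the new element is determined by `I` and `w`
  have core : ∀ w, w ∈ N → w ∉ M → w ≠ e → (∀ A, A ⊆ M → h (insert w A) = τ A) →
      h (insert e (insert w I)) ≤ f I + δ + c := by
    intro w hwN hwM hwe hw
    have sub : ∀ A, A ⊆ M → insert e (insert w A) ⊆ N := fun A hA =>
      Finset.insert_subset heN (Finset.insert_subset hwN (hA.trans hMN))
    have one : ∀ F ∈ 𝓜, I ⊆ F → h (insert e (insert w F)) ≤ f F + c := by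
      intro F hF hIF
      have hFM := hM F hF
      have b := hsub (insert e F) (insert w F)
        (Finset.insert_subset heN (hFM.trans hMN)) (Finset.insert_subset hwN (hFM.trans hMN))
      have u : insert e F ∪ insert w F = insert e (insert w F) := by
        ext z; simp only [Finset.mem_union, Finset.mem_insert]; tauto
      have i : insert e F ∩ insert w F = F := by
        ext z; simp only [Finset.mem_inter, Finset.mem_insert]
        constructor
        · rintro ⟨rfl | h, h' | h'⟩
          · exact absurd h'.symm hwe
          · exact h'
          · exact h
          · exact h
        · exact fun h => ⟨Or.inr h, Or.inr h⟩
      rw [u, i, ve F hFM, hw F hFM, v0 F hFM, hτ, Finset.union_eq_left.mpr hIF] at b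
      have := σF F F hF subset_rfl
      linarith
    have o1 := one F₁ hF₁ s1
    have o2 := one F₂ hF₂ s2
    have b := hsub _ _ (sub F₁ hM1) (sub F₂ hM2)
    have u : insert e (insert w F₁) ∪ insert e (insert w F₂) = insert e (insert w (F₁ ∪ F₂)) := by
      ext z; simp only [Finset.mem_union, Finset.mem_insert]; tauto
    have i : insert e (insert w F₁) ∩ insert e (insert w F₂) = insert e (insert w I) := by
      rw [hIdef]
      ext z; simp only [Finset.mem_inter, Finset.mem_insert]; tauto
    rw [u, i] at b
    have hUM := Finset.union_subset hM1 hM2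
    have m := hmono (insert w (F₁ ∪ F₂)) _ (Finset.subset_insert e _) (sub _ hUM)
    rw [hw _ hUM, hτ, Finset.union_eq_left.mpr (s1.trans Finset.subset_union_left)] at m
    have := σge _ hUM
    unfold modularDefect at hδ
    rw [← hIdef] at hδ
    linarith
  have cx := core x hxN hx.2 hx.1 vx
  have cy := core y hyN hy.2.2 hy.2.1 vy
  have hIN := hIM.trans hMN
  have b := hsub (insert e (insert x I)) (insert e (insert y I))
    (Finset.insert_subset heN (Finset.insert_subset hxN hIN))
    (Finset.insert_subset heN (Finset.insert_subset hyN hIN))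
  have m1 := hmono (insert e I) (insert e (insert x I) ∩ insert e (insert y I))
    (by intro z; simp only [Finset.mem_inter, Finset.mem_insert]; tauto)
    (Finset.inter_subset_left.trans
      (Finset.insert_subset heN (Finset.insert_subset hxN hIN)))
  have m2 := hmono (insert x (insert y I)) (insert e (insert x I) ∪ insert e (insert y I))
    (by intro z; simp only [Finset.mem_union, Finset.mem_insert]; tauto)
    (Finset.union_subset (Finset.insert_subset heN (Finset.insert_subset hxN hIN))
      (Finset.insert_subset heN (Finset.insert_subset hyN hIN)))
  rw [ve I hIM] at m1
  rw [vxy I hIM] at m2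
  linarith

/-- A polymatroid with a non-principal modular cut is not sticky:
there are two extensions, intersecting exactly in the ground set, with no amalgam. -/
theorem statement_0 {α : Type*} [DecidableEq α] [Infinite α]
    (M : Finset α) (f : Finset α → ℝ) (hf : IsPolymatroid M f)
    (𝓜 : Set (Finset α)) (h𝓜 : IsModularCut M f 𝓜) (hnp : ¬ IsPrincipal M 𝓜) :
    ¬ Sticky M f ∧
    ∃ N₁ g₁ N₂ g₂, IsExtension M f N₁ g₁ ∧ IsExtension M f N₂ g₂ ∧ N₁ ∩ N₂ = M ∧
      ¬ ∃ h, IsAmalgam N₁ g₁ N₂ g₂ h := by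
  have hmain := main_ext M f hf 𝓜 h𝓜 hnp
  refine ⟨fun hst => ?_, hmain⟩
  obtain ⟨N₁, g₁, N₂, g₂, h1, h2, h3, h4⟩ := hmain
  exact h4 (hst N₁ g₁ N₂ g₂ h1 h2 h3)
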